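/- Let k = m·2^n with m odd, n ≥ 0, and m ≡ 5 (mod 8). Then the truncated Thue–Morse morphism h_k = f_{0,k} is cubefree. -/

import Mathlib

/-- The Thue–Morse word: `tm n` is the parity of the number of 1s in the
binary representation of `n` (`true` = letter 1, `false` = letter 0). -/
def tm (n : ℕ) : Bool := ((Nat.digits 2 n).count 1) % 2 == 1

/-- The factor `t[ℓ..ℓ+k-1]` of the Thue–Morse word. -/
def tmFactor (ℓ k : ℕ) : List Bool := (List.range k).map (fun i => tm (ℓ + i))

/-- Complement of a binary word (exchange 0 and 1 in every position). -/
def wcompl (w : List Bool) : List Bool := w.map (fun b => !b)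

/-- Apply the binary morphism `0 ↦ h0, 1 ↦ h1` to the word `w`. -/
def applyMorph (h0 h1 : List Bool) (w : List Bool) : List Bool :=
  (w.map (fun b => bif b then h1 else h0)).flatten

/-- The Thue–Morse morphism μ : 0 ↦ 01, 1 ↦ 10. -/
def mu : List Bool → List Bool := applyMorph [false, true] [true, false]

/-- `p` is a period of the finite word `w`: `1 ≤ p ≤ |w|` and `w[i] = w[i+p]`
for all `i` with `i + p < |w|`. -/
def HasPeriodW (w : List Bool) (p : ℕ) : Prop :=
  1 ≤ p ∧ p ≤ w.length ∧ ∀ i, i + p < w.length → w.getD i false = w.getD (i + p) false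

/-- The smallest period of `w`. -/
noncomputable def per (w : List Bool) : ℕ := sInf {p | HasPeriodW w p}

/-- The exponent of `w`: `|w| / per(w)`. -/
noncomputable def wexp (w : List Bool) : ℝ := (w.length : ℝ) / (per w : ℝ)

/-- The critical exponent of `w`: supremum of exponents of nonempty factors of `w`. -/
noncomputable def ce (w : List Bool) : ℝ :=
  sSup {r : ℝ | ∃ x : List Bool, x ≠ [] ∧ x <:+: w ∧ r = wexp x}

/-- A `k`-prefix: the length-`k` prefix of the Thue–Morse word, or its complement. -/
def kPrefix (k : ℕ) (s : List Bool) : Prop :=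
  s = tmFactor 0 k ∨ s = wcompl (tmFactor 0 k)

/-- `v` is a finite factor of the Thue–Morse word. -/
def IsTMFactor (v : List Bool) : Prop := ∃ ℓ, v = tmFactor ℓ v.length

/-- The complementary morphism `0 ↦ h0, 1 ↦ complement of h0` is cubefree:
it maps every word of critical exponent `< 3` to a word of critical exponent `< 3`. -/
def CubefreeC (h0 : List Bool) : Prop :=
  ∀ w : List Bool, ce w < 3 → ce (applyMorph h0 (wcompl h0) w) < 3

/-- The word `x` occurs at position `i` of the word `w`. -/
def OccursAt (x w : List Bool) (i : ℕ) : Prop :=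
  i + x.length ≤ w.length ∧ (w.drop i).take x.length = x

/-! ### Recursion for the Thue–Morse word -/

theorem tm_double (n : ℕ) : tm (2 * n) = tm n := by
  rcases Nat.eq_zero_or_pos n with rfl | hn
  · rfl
  · have := Nat.digits_add_two_add_one 0 (2 * n - 1)
    have h : 2 * n - 1 + 1 = 2 * n := by omega
    rw [h] at this
    simp only [tm]
    rw [show (2 : ℕ) = 0 + 2 from rfl, this]
    simp

theorem tm_double_succ (n : ℕ) : tm (2 * n + 1) = !tm n := by
  have := Nat.digits_add_two_add_one 0 (2 * n)
  have h1 : (2 * n + 1) % (0 + 2) = 1 := by omega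
  have h2 : (2 * n + 1) / (0 + 2) = n := by omega
  rw [h1, h2] at this
  simp only [tm]
  rw [show (2 : ℕ) = 0 + 2 from rfl, this]
  simp only [List.count_cons_self]
  rcases Nat.mod_two_eq_zero_or_one (List.count 1 (Nat.digits (0 + 2) n)) with h | h
  · simp [h, Nat.add_mod]
  · simp [h, Nat.add_mod]

theorem tm_succ_of_even {n : ℕ} (h : n % 2 = 0) : tm (n + 1) = !tm n := by
  obtain ⟨m, rfl⟩ : ∃ m, n = 2 * m := ⟨n / 2, by omega⟩
  rw [tm_double_succ, tm_double]

theorem tm_eq_half (n : ℕ) : tm n = xor (tm (n / 2)) (n % 2 == 1) := by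
  rcases Nat.mod_two_eq_zero_or_one n with h | h
  · conv_lhs => rw [show n = 2 * (n / 2) by omega]
    simp [tm_double, h]
  · conv_lhs => rw [show n = 2 * (n / 2) + 1 by omega]
    simp [tm_double_succ, h]

theorem tm_zero : tm 0 = false := by simp [tm]
theorem tm_one : tm 1 = true := by simpa [tm_zero] using tm_double_succ 0
theorem tm_two : tm 2 = true := by simpa [tm_one] using tm_double 1
theorem tm_three : tm 3 = false := by simpa [tm_one] using tm_double_succ 1
theorem tm_four : tm 4 = true := by simpa [tm_two] using tm_double 2
theorem tm_six : tm 6 = false := by simpa [tm_three] using tm_double 3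

/-! ### Repetitions in the Thue–Morse word -/

/-- A word made of blocks `01` and `10` has no overlap with odd period. -/
theorem no_odd_overlap {F : ℕ → Bool} (hF : ∀ n, n % 2 = 0 → F (n + 1) = !F n) {i p : ℕ}
    (hp : p % 2 = 1) (h : ∀ j ≤ p, F (i + j) = F (i + j + p)) : False := by
  have step : ∀ j < p, F (i + j + 1) = !F (i + j) := by
    intro j hj
    rcases Nat.mod_two_eq_zero_or_one (i + j) with h0 | h0
    · exact hF _ h0
    · have h1 := h j hj.le
      have h2 := h (j + 1) hj
      rw [← add_assoc] at h2
      rw [h1, h2, show i + j + 1 + p = i + j + p + 1 by omega]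
      exact hF _ (by omega)
  have alt : ∀ j ≤ p, F (i + j) = xor (F i) (j % 2 == 1) := by
    intro j
    induction j with
    | zero => simp
    | succ j ih =>
      intro hj
      rw [← add_assoc, step j hj, ih (by omega)]
      rcases Nat.mod_two_eq_zero_or_one j with h0 | h0
      · simp [h0, Nat.add_mod]
      · simp [h0, Nat.add_mod]
  have h1 := h 0 (by omega)
  have h2 := alt p le_rfl
  simp [hp] at h1 h2
  simp [← h1] at h2

theorem tm_overlap_free {i p : ℕ} (hp : 0 < p)
    (h : ∀ j ≤ p, tm (i + j) = tm (i + j + p)) : False := by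
  induction p using Nat.strong_induction_on generalizing i with
  | _ p ih =>
    rcases Nat.mod_two_eq_zero_or_one p with h0 | h0
    · refine ih (p / 2) (by omega) (i := i / 2) (by omega) fun j hj => ?_
      have key : ∀ x, i ≤ x → x ≤ i + p → tm (x / 2) = tm (x / 2 + p / 2) := by
        intro x hx hx'
        have := h (x - i) (by omega)
        rw [show i + (x - i) = x by omega, tm_eq_half x, tm_eq_half (x + p),
          show (x + p) / 2 = x / 2 + p / 2 by omega, show (x + p) % 2 = x % 2 by omega] at this
        simpa using this
      have := key (i + 2 * j) (by omega) (by omega)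
      rwa [show (i + 2 * j) / 2 = i / 2 + j by omega] at this
    · exact no_odd_overlap (fun n hn => tm_succ_of_even hn) h0 h

theorem tm_ne_of_prefix_occurrence {s : ℕ} {e : Bool} (hs : s % 2 = 1)
    (h1 : tm (s + 1) = xor e (tm 1)) (h2 : tm (s + 2) = xor e (tm 2)) : False := by
  have := tm_succ_of_even (n := s + 1) (by omega)
  rw [h1, show s + 1 + 1 = s + 2 from rfl, h2, tm_one, tm_two] at this
  cases e <;> simp at this

theorem tm_no_square_prefix {p : ℕ} (hp : 0 < p) (h : ∀ j < p, tm j = tm (j + p)) : False := by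
  induction p using Nat.strong_induction_on with
  | _ p ih =>
    rcases Nat.mod_two_eq_zero_or_one p with h0 | h0
    · refine ih (p / 2) (by omega) (by omega) fun j hj => ?_
      have := h (2 * j) (by omega)
      rwa [show 2 * j + p = 2 * (j + p / 2) by omega, tm_double, tm_double] at this
    · rcases Nat.lt_or_ge p 3 with h3 | h3
      · obtain rfl : p = 1 := by omega
        simpa [tm_zero, tm_one] using h 0 (by omega)
      · refine tm_ne_of_prefix_occurrence (s := p) (e := false) h0 ?_ ?_
        · simpa [add_comm] using (h 1 (by omega)).symm
        · simpa [add_comm] using (h 2 (by omega)).symm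

/-- A prefix of odd length at least 5 occurs only at block boundaries in a concatenation of
such prefixes and their complements. -/
theorem tm_prefix_synchronizing {k s : ℕ} (hk : k % 2 = 1) (hk5 : 5 ≤ k) (hs : 0 < s) (hsk : s < k)
    {e f : Bool} (h1 : ∀ j, j + s < k → tm (s + j) = xor e (tm j))
    (h2 : ∀ j < s, tm (k - s + j) = xor f (tm j)) : False := by
  have short : ∀ {s : ℕ} {e : Bool}, s % 2 = 0 → s = 2 →
      (∀ j < 3, tm (s + j) = xor e (tm j)) → False := by
    rintro s e - rfl h
    have h0 := h 0 (by omega)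
    have h2 := h 2 (by omega)
    simp [tm_zero, tm_two, tm_four] at h0 h2
    simp [h0] at h2
  rcases Nat.mod_two_eq_zero_or_one s with h0 | h0
  · rcases Nat.lt_or_ge s 3 with h3 | h3
    · exact short (s := s) h0 (by omega) fun j hj => h1 j (by omega)
    · exact tm_ne_of_prefix_occurrence (s := k - s) (by omega) (h2 1 (by omega)) (h2 2 (by omega))
  · rcases Nat.lt_or_ge (k - s) 3 with h3 | h3
    · exact short (s := k - s) (by omega) (by omega) fun j hj => h2 j (by omega)
    · exact tm_ne_of_prefix_occurrence h0 (h1 1 (by omega)) (h1 2 (by omega))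

theorem tm_near_end {k : ℕ} (hk : k % 8 = 5) :
    tm (k - 3) = tm (k - 4) ∧ tm (k - 2) = !tm (k - 4) ∧ tm (k - 1) = tm (k - 4) := by
  obtain ⟨j, rfl⟩ : ∃ j, k = 8 * j + 5 := ⟨k / 8, by omega⟩
  have h4 : tm (8 * j + 5 - 4) = !tm j := by
    rw [show 8 * j + 5 - 4 = 2 * (2 * (2 * j)) + 1 by omega]
    simp only [tm_double_succ, tm_double]
  have h3 : tm (8 * j + 5 - 3) = !tm j := by
    rw [show 8 * j + 5 - 3 = 2 * (2 * (2 * j) + 1) by omega]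
    simp only [tm_double_succ, tm_double]
  have h2 : tm (8 * j + 5 - 2) = tm j := by
    rw [show 8 * j + 5 - 2 = 2 * (2 * (2 * j) + 1) + 1 by omega]
    simp only [tm_double_succ, tm_double, Bool.not_not]
  have h1 : tm (8 * j + 5 - 1) = !tm j := by
    rw [show 8 * j + 5 - 1 = 2 * (2 * (2 * j + 1)) by omega]
    simp only [tm_double_succ, tm_double]
  rw [h1, h2, h3, h4]
  simp

/-! ### Cubes in images of infinite words -/

/-- The image of the infinite word `W` under the truncated Thue–Morse morphism. -/
def tmImage (k : ℕ) (W : ℕ → Bool) (n : ℕ) : Bool := xor (W (n / k)) (tm (n % k))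

/-- The word `F` has a cube of period `p` at position `i`. -/
def CubeAt (F : ℕ → Bool) (i p : ℕ) : Prop := ∀ x, i ≤ x → x < i + 2 * p → F x = F (x + p)

theorem tmImage_block (k : ℕ) (W : ℕ → Bool) (c : ℕ) {j : ℕ} (hj : j < k) :
    tmImage k W (k * c + j) = xor (W c) (tm j) := by
  have hk : 0 < k := by omega
  simp [tmImage, Nat.mul_add_div hk, Nat.div_eq_of_lt hj, Nat.mod_eq_of_lt hj]

theorem xor_eq_iff_right {a b c d : Bool} (h : xor a b = xor c d) : b = xor (xor a c) d := by
  revert h; cases a <;> cases b <;> cases c <;> cases d <;> decide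

theorem no_cube_inside_block {k : ℕ} {W : ℕ → Bool} {i p c : ℕ} (hp : 0 < p)
    (h : CubeAt (tmImage k W) i p) (h1 : k * c ≤ i) (h2 : i + 3 * p ≤ k * c + k) : False := by
  refine tm_overlap_free (i := i - k * c) hp fun j hj => ?_
  have := h (i + j) (by omega) (by omega)
  rw [show i + j = k * c + (i - k * c + j) by omega, add_assoc,
    tmImage_block k W c (by omega), tmImage_block k W c (by omega)] at this
  simpa using this

theorem no_misaligned_block {k : ℕ} (hk : k % 2 = 1) (hk5 : 5 ≤ k) {W : ℕ → Bool} {c y : ℕ}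
    (hy : ¬ k ∣ y) (h : ∀ j < k, tmImage k W (k * c + j) = tmImage k W (y + j)) : False := by
  have hyk := Nat.div_add_mod y k
  have hs : y % k < k := Nat.mod_lt _ (by omega)
  have hs0 : 0 < y % k := Nat.pos_of_ne_zero fun h0 => hy (Nat.dvd_of_mod_eq_zero h0)
  generalize y % k = s at *
  generalize y / k = d at *
  refine tm_prefix_synchronizing hk hk5 hs0 hs (e := xor (W d) (W c)) (f := xor (W c) (W (d + 1)))
    (fun j hj => ?_) (fun j hj => ?_)
  · have := h j (by omega)
    rw [← hyk, add_assoc, tmImage_block k W c (by omega), tmImage_block k W d (by omega)] at this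
    exact xor_eq_iff_right this.symm
  · have := h (k - s + j) (by omega)
    rw [← hyk, show k * d + s + (k - s + j) = k * (d + 1) + j by rw [mul_add]; omega,
      tmImage_block k W c (by omega), tmImage_block k W (d + 1) (by omega)] at this
    exact xor_eq_iff_right this

theorem no_cube_around_block {k : ℕ} (hk : k % 2 = 1) (hk5 : 5 ≤ k) {W : ℕ → Bool} {i p c : ℕ}
    (h : CubeAt (tmImage k W) i p) (h1 : i ≤ k * c) (h2 : k * c + k ≤ i + 3 * p)
    (h3 : k * c < i + p) (h4 : i + 2 * p < k * c + k) : False := by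
  have mid : ∀ j, j + p < k → tm j = tm (j + p) := by
    intro j hj
    have := h (k * c + j) (by omega) (by omega)
    rw [add_assoc, tmImage_block k W c (by omega), tmImage_block k W c (by omega)] at this
    simpa using this
  have right : ∀ j, k * c + k + j < i + 3 * p →
      tm (k - p + j) = xor (xor (W c) (W (c + 1))) (tm j) := by
    intro j hj
    have := h (k * c + (k - p + j)) (by omega) (by omega)
    rw [show k * c + (k - p + j) + p = k * (c + 1) + j by rw [mul_add]; omega,
      tmImage_block k W c (by omega), tmImage_block k W (c + 1) (by omega)] at this
    exact xor_eq_iff_right this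
  rcases Nat.mod_two_eq_zero_or_one p with hp | hp
  · by_cases e2 : k * c + k + 2 < i + 3 * p
    · exact tm_ne_of_prefix_occurrence (s := k - p) (by omega) (right 1 (by omega))
        (right 2 (by omega))
    · refine tm_no_square_prefix (p := p / 2) (by omega) fun j hj => ?_
      have := mid (2 * j) (by omega)
      rwa [show 2 * j + p = 2 * (j + p / 2) by omega, tm_double, tm_double] at this
  · rcases Nat.lt_or_ge (k - p) 3 with hkp | hkp
    · have hkp2 : k - p = 2 := by omega
      by_cases e2 : k * c + k + 2 < i + 3 * p
      · have r0 := right 0 (by omega)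
        have r2 := right 2 (by omega)
        generalize xor (W c) (W (c + 1)) = e at *
        simp [hkp2, tm_zero, tm_two, tm_four] at r0 r2
        simp [r0] at r2
      · obtain rfl : k = 5 := by omega
        obtain rfl : p = 3 := by omega
        obtain ⟨d, rfl⟩ : ∃ d, c = d + 1 := ⟨c - 1, by omega⟩
        have l0 := h (5 * d + 3) (by omega) (by omega)
        have l1 := h (5 * d + 4) (by omega) (by omega)
        rw [show 5 * d + 3 + 3 = 5 * (d + 1) + 1 by omega, tmImage_block 5 W d (by omega),
          tmImage_block 5 W (d + 1) (by omega)] at l0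
        rw [show 5 * d + 4 + 3 = 5 * (d + 1) + 2 by omega, tmImage_block 5 W d (by omega),
          tmImage_block 5 W (d + 1) (by omega)] at l1
        simp [tm_one, tm_two, tm_three, tm_four] at l0 l1
        rw [l0] at l1
        simp at l1
    · refine tm_ne_of_prefix_occurrence (s := p) (e := false) hp ?_ ?_
      · simpa [add_comm] using (mid 1 (by omega)).symm
      · simpa [add_comm] using (mid 2 (by omega)).symm

theorem no_cube_across_boundary {k : ℕ} (hk : k % 8 = 5) {W : ℕ → Bool} {i p c : ℕ} (hp0 : 0 < p)
    (h : CubeAt (tmImage k W) i p) (h1 : k * c < i) (h2 : i < k * c + k)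
    (h3 : k * c + k < i + 3 * p) (h4 : i + 3 * p < k * c + 2 * k) : False := by
  have pre : ∀ j, k * c + k + j + p < i + 3 * p → tm j = tm (j + p) := by
    intro j hj
    have := h (k * (c + 1) + j) (by rw [mul_add]; omega) (by rw [mul_add]; omega)
    rw [add_assoc, tmImage_block k W _ (by omega), tmImage_block k W _ (by omega)] at this
    simpa using this
  have suf : ∀ x, i ≤ k * c + x → x + p < k → tm x = tm (x + p) := by
    intro x hx hx'
    have := h (k * c + x) hx (by omega)
    rw [add_assoc, tmImage_block k W _ (by omega), tmImage_block k W _ (by omega)] at this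
    simpa using this
  have e2 : i + 3 * p < k * c + k + 2 * p := by
    by_contra hc
    exact tm_no_square_prefix hp0 fun j hj => pre j (by omega)
  have e1 : k * c + k ≤ i + 2 * p := by
    by_contra hc
    refine tm_overlap_free (i := i - k * c) hp0 fun j hj => suf _ (by omega) (by omega)
  have cross : ∀ j < p, tm (k - p + j) = xor (xor (W c) (W (c + 1))) (tm j) := by
    intro j hj
    have := h (k * c + (k - p + j)) (by omega) (by omega)
    rw [show k * c + (k - p + j) + p = k * (c + 1) + j by rw [mul_add]; omega,
      tmImage_block k W c (by omega), tmImage_block k W (c + 1) (by omega)] at this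
    exact xor_eq_iff_right this
  obtain ⟨t3, t2, t1⟩ := tm_near_end hk
  generalize xor (W c) (W (c + 1)) = e at *
  rcases Nat.mod_two_eq_zero_or_one p with hp | hp
  · rcases Nat.lt_or_ge p 3 with hp3 | hp3
    · obtain rfl : p = 2 := by omega
      by_cases hc : k * c + k + 2 < i + 3 * 2
      · have := pre 0 (by omega)
        simp [tm_zero, tm_two] at this
      · have := suf (k - 4) (by omega) (by omega)
        rw [show k - 4 + 2 = k - 2 by omega, t2] at this
        simp at this
    · exact tm_ne_of_prefix_occurrence (s := k - p) (by omega) (cross 1 (by omega))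
        (cross 2 (by omega))
  · by_cases hp1 : p = 1
    · subst hp1
      have := suf (k - 2) (by omega) (by omega)
      rw [show k - 2 + 1 = k - 1 by omega, t2, t1] at this
      simp at this
    by_cases hp3 : p = 3
    · subst hp3
      have c1 := cross 1 (by omega)
      have c2 := cross 2 (by omega)
      rw [show k - 3 + 1 = k - 2 by omega, t2, tm_one] at c1
      rw [show k - 3 + 2 = k - 1 by omega, t1, tm_two] at c2
      rw [c2] at c1
      simp at c1
    have e2' : i + 3 * p ≤ k * c + k + p + 2 := by
      by_contra hc
      refine tm_ne_of_prefix_occurrence (s := p) (e := false) hp ?_ ?_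
      · simpa [add_comm] using (pre 1 (by omega)).symm
      · simpa [add_comm] using (pre 2 (by omega)).symm
    have e1' : i + p + 4 ≤ k * c + k := by
      by_contra hc
      obtain rfl : p = 5 := by omega
      have := pre 1 (by omega)
      simp [tm_one, tm_six] at this
    have s4 := suf (k - 4 - p) (by omega) (by omega)
    have s3 := suf (k - 4 - p + 1) (by omega) (by omega)
    rw [show k - 4 - p + p = k - 4 by omega] at s4
    rw [show k - 4 - p + 1 + p = k - 3 by omega, t3, ← s4,
      tm_succ_of_even (by omega)] at s3
    simp at s3

theorem dvd_period_of_cubeAt_tmImage {k : ℕ} (hk : k % 8 = 5) {W : ℕ → Bool} {i p : ℕ}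
    (hp : 0 < p) (h : CubeAt (tmImage k W) i p) : k ∣ p := by
  by_contra hd
  have hk5 : 5 ≤ k := by omega
  have hk2 : k % 2 = 1 := by omega
  by_cases hb : ∃ c, i ≤ k * c ∧ k * c + k ≤ i + 3 * p
  · obtain ⟨c, h1, h2⟩ := hb
    by_cases h4 : k * c + k ≤ i + 2 * p
    · refine no_misaligned_block hk2 hk5 (c := c) (y := k * c + p) (W := W) ?_ fun j hj => ?_
      · rwa [Nat.dvd_add_right (dvd_mul_right k c)]
      · rw [h (k * c + j) (by omega) (by omega), add_right_comm]
    · by_cases h3 : i + p ≤ k * c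
      · refine no_misaligned_block hk2 hk5 (c := c) (y := k * c - p) (W := W) ?_ fun j hj => ?_
        · intro hy
          apply hd
          have := Nat.dvd_sub (dvd_mul_right k c) hy
          rwa [show k * c - (k * c - p) = p by omega] at this
        · rw [h (k * c - p + j) (by omega) (by omega)]
          congr 1
          omega
      · exact no_cube_around_block hk2 hk5 h h1 h2 (by omega) (by omega)
  · push Not at hb
    have hi := Nat.div_add_mod i k
    have hm : i % k < k := Nat.mod_lt _ (by omega)
    have b1 := hb (i / k)
    have b2 := hb (i / k + 1)
    rw [mul_add] at b2
    by_cases h3 : i + 3 * p ≤ k * (i / k) + k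
    · exact no_cube_inside_block hp h (c := i / k) (by omega) h3
    · exact no_cube_across_boundary hk hp h (c := i / k) (by omega) (by omega) (by omega) (by omega)

theorem exists_cube_of_dvd {k : ℕ} {W : ℕ → Bool} {i q L : ℕ} (hk : 0 < k)
    (h : CubeAt (tmImage k W) i (k * q)) (hL : i + 3 * (k * q) ≤ k * L) :
    ∃ i', CubeAt W i' q ∧ i' + 3 * q ≤ L := by
  have hi := Nat.div_add_mod i k
  have hm : i % k < k := Nat.mod_lt _ hk
  refine ⟨i / k, fun x hx hx' => ?_, ?_⟩
  · have hx2 : k * (x + 1) ≤ k * (i / k + 2 * q) := Nat.mul_le_mul_left _ hx'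
    have hx1 : k * (i / k) ≤ k * x := Nat.mul_le_mul_left _ hx
    rw [mul_add, mul_add, mul_left_comm] at hx2
    have := h (k * x + i % k) (by omega) (by omega)
    rw [show k * x + i % k + k * q = k * (x + q) + i % k by ring, tmImage_block k W _ hm,
      tmImage_block k W _ hm] at this
    simpa using this
  · have : k * (i / k + 3 * q) ≤ k * L := by
      rw [mul_add, mul_left_comm]
      omega
    exact Nat.le_of_mul_le_mul_left this hk

theorem tmImage_two_mul (k : ℕ) (W : ℕ → Bool) (n : ℕ) :
    tmImage (2 * k) W n = xor (tmImage k W (n / 2)) (n % 2 == 1) := by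
  simp only [tmImage]
  rw [tm_eq_half (n % (2 * k)), Nat.mod_mul_right_div_self, Nat.mod_mul_right_mod,
    Nat.div_div_eq_div_mul, Bool.xor_assoc]

theorem exists_half_cube {k : ℕ} {W : ℕ → Bool} {i p L : ℕ} (hp : 0 < p)
    (h : CubeAt (tmImage (2 * k) W) i p) (hL : i + 3 * p ≤ 2 * L) :
    ∃ i' p', 0 < p' ∧ CubeAt (tmImage k W) i' p' ∧ i' + 3 * p' ≤ L := by
  rcases Nat.mod_two_eq_zero_or_one p with h0 | h0
  · refine ⟨i / 2, p / 2, by omega, fun x hx hx' => ?_, by omega⟩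
    have := h (2 * x + i % 2) (by omega) (by omega)
    rw [tmImage_two_mul, tmImage_two_mul, show (2 * x + i % 2) / 2 = x by omega,
      show (2 * x + i % 2 + p) / 2 = x + p / 2 by omega,
      show (2 * x + i % 2 + p) % 2 = (2 * x + i % 2) % 2 by omega] at this
    simpa using this
  · refine (no_odd_overlap (F := tmImage (2 * k) W) (fun n hn => ?_) h0
      fun j hj => h (i + j) (by omega) (by omega)).elim
    rw [tmImage_two_mul, tmImage_two_mul, show (n + 1) / 2 = n / 2 by omega,
      show (n + 1) % 2 = 1 by omega, hn]
    simp

theorem exists_cube_of_cubeAt_tmImage {m : ℕ} (hm : m % 8 = 5) (n : ℕ) {W : ℕ → Bool} {i p L : ℕ}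
    (hp : 0 < p) (h : CubeAt (tmImage (m * 2 ^ n) W) i p) (hL : i + 3 * p ≤ m * 2 ^ n * L) :
    ∃ i' p', 0 < p' ∧ CubeAt W i' p' ∧ i' + 3 * p' ≤ L := by
  induction n generalizing i p with
  | zero =>
    simp only [pow_zero, mul_one] at h hL
    obtain ⟨q, rfl⟩ := dvd_period_of_cubeAt_tmImage hm hp h
    obtain ⟨i', h1, h2⟩ := exists_cube_of_dvd (by omega) h hL
    exact ⟨i', q, Nat.pos_of_mul_pos_left hp, h1, h2⟩
  | succ n ih =>
    rw [show m * 2 ^ (n + 1) = 2 * (m * 2 ^ n) by ring] at h hL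
    rw [mul_assoc 2] at hL
    obtain ⟨i', p', hp', h', hL'⟩ := exists_half_cube hp h hL
    exact ih hp' h' hL'

/-! ### Critical exponents of finite words -/

theorem hasPeriodW_per {x : List Bool} (hx : x ≠ []) : HasPeriodW x (per x) :=
  Nat.sInf_mem (s := {p | HasPeriodW x p})
    ⟨x.length, List.length_pos_of_ne_nil hx, le_rfl, fun i hi => by omega⟩

theorem finite_setOf_factor_exponents (w : List Bool) :
    {r : ℝ | ∃ x : List Bool, x ≠ [] ∧ x <:+: w ∧ r = wexp x}.Finite := by
  refine ((w.sublists.toFinset.finite_toSet).image wexp).subset ?_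
  rintro r ⟨x, -, hx, rfl⟩
  exact ⟨x, by simpa using hx.sublist, rfl⟩

theorem three_le_wexp_iff {x : List Bool} (hx : x ≠ []) : 3 ≤ wexp x ↔ 3 * per x ≤ x.length := by
  have hp : (0 : ℝ) < per x := by exact_mod_cast (hasPeriodW_per hx).1
  rw [wexp, le_div_iff₀ hp]
  exact_mod_cast Iff.rfl

theorem getD_infix (s x t : List Bool) {j : ℕ} (hj : j < x.length) :
    (s ++ x ++ t).getD (s.length + j) false = x.getD j false := by
  rw [List.append_assoc, List.getD_append_right _ _ _ _ (by omega), Nat.add_sub_cancel_left,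
    List.getD_append _ _ _ _ hj]

theorem ce_lt_three_iff (w : List Bool) :
    ce w < 3 ↔ ∀ i p, 0 < p → CubeAt (fun n => w.getD n false) i p → ¬ i + 3 * p ≤ w.length := by
  have hfin := finite_setOf_factor_exponents w
  constructor
  · intro h i p hp hc hL
    set x := (w.drop i).take (3 * p) with hx
    have hlen : x.length = 3 * p := by simp [hx]; omega
    have hne : x ≠ [] := by
      rintro h0
      rw [h0] at hlen
      simp at hlen
      omega
    have hinf : x <:+: w := ((w.drop i).take_prefix _).isInfix.trans (w.drop_suffix i).isInfix
    have hget : ∀ j < 3 * p, x.getD j false = w.getD (i + j) false := by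
      intro j hj
      simp [hx, List.getD_eq_getElem?_getD, hj]
    have hper : HasPeriodW x p := by
      refine ⟨hp, by omega, fun j hj => ?_⟩
      rw [hget j (by omega), hget (j + p) (by omega), ← add_assoc]
      exact hc (i + j) (by omega) (by omega)
    have hle : per x ≤ p := Nat.sInf_le hper
    have h3 : 3 ≤ wexp x := (three_le_wexp_iff hne).2 (by omega)
    exact absurd (le_csSup hfin.bddAbove ⟨x, hne, hinf, rfl⟩) (not_le.2 (h.trans_le h3))
  · intro h
    rcases Set.eq_empty_or_nonempty
      {r : ℝ | ∃ x : List Bool, x ≠ [] ∧ x <:+: w ∧ r = wexp x} with h0 | h0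
    · rw [ce, h0, Real.sSup_empty]
      norm_num
    · rw [ce, hfin.csSup_lt_iff h0]
      rintro r ⟨x, hne, ⟨s, t, rfl⟩, rfl⟩
      by_contra hr
      rw [not_lt, three_le_wexp_iff hne] at hr
      have hper := hasPeriodW_per hne
      refine h s.length (per x) hper.1 (fun y hy hy' => ?_) (by simp; omega)
      obtain ⟨j, rfl⟩ : ∃ j, y = s.length + j := ⟨y - s.length, by omega⟩
      simp only
      rw [add_assoc, getD_infix _ _ _ (by omega), getD_infix _ _ _ (by omega)]
      exact hper.2.2 j (by omega)

theorem length_applyMorph_tmFactor (k : ℕ) (w : List Bool) :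
    (applyMorph (tmFactor 0 k) (wcompl (tmFactor 0 k)) w).length = k * w.length := by
  induction w with
  | nil => simp [applyMorph]
  | cons b w ih =>
    simp only [applyMorph] at ih
    cases b <;> simp [applyMorph, tmFactor, wcompl, mul_add, add_comm] at ih ⊢ <;> exact ih

theorem getD_applyMorph_tmFactor {k : ℕ} (w : List Bool) {n : ℕ} (hn : n < k * w.length) :
    (applyMorph (tmFactor 0 k) (wcompl (tmFactor 0 k)) w).getD n false =
      tmImage k (fun n => w.getD n false) n := by
  induction w generalizing n with
  | nil => simp at hn
  | cons b w ih =>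
    have hk : 0 < k := Nat.pos_of_ne_zero fun h0 => by simp [h0] at hn
    set B := bif b then wcompl (tmFactor 0 k) else tmFactor 0 k with hB
    have hlen : B.length = k := by cases b <;> simp [hB, tmFactor, wcompl]
    have happ : applyMorph (tmFactor 0 k) (wcompl (tmFactor 0 k)) (b :: w) =
        B ++ applyMorph (tmFactor 0 k) (wcompl (tmFactor 0 k)) w := by
      simp [applyMorph, hB]
    rw [happ]
    rcases Nat.lt_or_ge n k with h | h
    · rw [List.getD_append _ _ _ _ (by omega)]
      cases b <;> simp [hB, tmFactor, wcompl, tmImage, Nat.div_eq_of_lt h, Nat.mod_eq_of_lt h, h,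
        List.getD_eq_getElem?_getD]
    · rw [List.getD_append_right _ _ _ _ (by omega), hlen, ih (by
        rw [List.length_cons, mul_add] at hn; omega)]
      obtain ⟨d, rfl⟩ : ∃ d, n = d + k := ⟨n - k, by omega⟩
      simp [tmImage, Nat.add_div_right _ hk]

/-- for `k = m·2ⁿ` with `m` odd and `m ≡ 5 (mod 8)`, the
truncated Thue–Morse morphism `h_k = f_{0,k}` is cubefree. -/
theorem stmt12 (m n k : ℕ) (hm : Odd m) (hm8 : m % 8 = 5) (hk : k = m * 2 ^ n) :
    CubefreeC (tmFactor 0 k) := by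
  intro w hw
  rw [ce_lt_three_iff] at hw ⊢
  intro i p hp hc hL
  rw [length_applyMorph_tmFactor] at hL
  have hc' : CubeAt (tmImage k fun n => w.getD n false) i p := by
    intro x hx hx'
    have := hc x hx hx'
    simp only at this
    rwa [getD_applyMorph_tmFactor w (by omega), getD_applyMorph_tmFactor w (by omega)] at this
  subst hk
  obtain ⟨i', p', hp', hcube, hle⟩ := exists_cube_of_cubeAt_tmImage hm8 n hp hc' hL
  exact hw i' p' hp' hcube hle
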